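/- arXiv:2305.00563 — 2 statements merged into one kernel-verified Lean document; each statement's English description precedes it below -/
import Mathlib

section
/- (Theorem 2) For every real y ∈ [0,1] and every positive integer n, the function σ satisfies σ(n−y) = σ(n) + Σ_{j=1}^{n−1} (−1)^j · σ(n−j) · M_{j,n}(y). -/
/-- The multiple polylogarithm `M_{j,n}(y)`: the nested sum over strictly decreasing
tuples `n₁ > n₂ > … > n_j > 0` of `∏ᵢ zᵢ^{nᵢ}/nᵢ`, where `z₁ = y/n` and
`zᵢ = (n+2−i)/(n+1−i)` for `1 < i ≤ j`. By convention `M_{0,n}(y) = 1`. -/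
noncomputable def M (j n : ℕ) (y : ℝ) : ℝ :=
  ∑' f : {f : Fin j → ℕ // StrictAnti f ∧ ∀ i, 0 < f i},
    ∏ i : Fin j,
      (if (i : ℕ) = 0 then y / n else ((n : ℝ) + 1 - (i : ℕ)) / ((n : ℝ) - (i : ℕ))) ^ (f.1 i)
        / (f.1 i : ℝ)

abbrev TA (j : ℕ) := {f : Fin j → ℕ // StrictAnti f ∧ ∀ i, 0 < f i}

noncomputable def TT (j n : ℕ) (f : TA j) (y : ℝ) : ℝ :=
  ∏ i : Fin j,
      (if (i : ℕ) = 0 then y / n else ((n : ℝ) + 1 - (i : ℕ)) / ((n : ℝ) - (i : ℕ))) ^ (f.1 i)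
        / (f.1 i : ℝ)

def hd : (j : ℕ) → TA j → ℕ
  | 0, _ => 0
  | _ + 1, f => f.1 0

theorem hd_lt (j : ℕ) (f : TA j) (i : Fin j) : f.1 i ≤ hd j f := by
  cases j with
  | zero => exact i.elim0
  | succ j => exact f.2.1.antitone (Fin.zero_le i)

def extFun (j : ℕ) (p : TA j × ℕ) : TA (j + 1) :=
  ⟨Fin.cons (hd j p.1 + p.2 + 1) p.1.1, by
    constructor
    · intro a b hab
      induction b using Fin.cases with
      | zero => exact absurd hab (Fin.not_lt_zero a)
      | succ b =>
        induction a using Fin.cases with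
        | zero =>
          have := hd_lt j p.1 b
          simp only [Fin.cons_zero, Fin.cons_succ]
          omega
        | succ a =>
          simp only [Fin.cons_succ]
          exact p.1.2.1 (Fin.succ_lt_succ_iff.mp hab)
    · intro i
      induction i using Fin.cases with
      | zero => simp
      | succ i => simpa using p.1.2.2 i⟩

theorem extFun_bij (j : ℕ) : Function.Bijective (extFun j) := by
  constructor
  · rintro ⟨f, k⟩ ⟨g, l⟩ h
    have h1 := congrArg Subtype.val h
    simp only [extFun] at h1
    obtain ⟨h2, h3⟩ := Fin.cons_inj.mp h1
    have h4 : f = g := Subtype.ext h3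
    subst h4
    simp only [Prod.mk.injEq, true_and]
    omega
  · intro g
    let f : TA j := ⟨fun i => g.1 i.succ,
      fun a b hab => g.2.1 (Fin.succ_lt_succ_iff.mpr hab), fun i => g.2.2 _⟩
    have hf : hd j f < g.1 0 := by
      cases j with
      | zero => exact g.2.2 0
      | succ j => exact g.2.1 (Fin.succ_pos 0)
    refine ⟨(f, g.1 0 - hd j f - 1), ?_⟩
    apply Subtype.ext
    funext i
    induction i using Fin.cases with
    | zero => simp only [extFun, Fin.cons_zero]; omega
    | succ i => simp [extFun, f]

theorem TT_pow (j n : ℕ) (f : TA j) (y : ℝ) : TT j n f y = y ^ hd j f * TT j n f 1 := by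
  cases j with
  | zero => simp [TT, hd]
  | succ j =>
    simp only [TT, Fin.prod_univ_succ, hd]
    simp [div_pow]
    ring

theorem TT_ext (j n : ℕ) (hn : 0 < n) (f : TA j) (k : ℕ) (y : ℝ) :
    TT (j + 1) (n + 1) (extFun j (f, k)) y =
      y ^ (hd j f + k + 1) / ((hd j f + k + 1 : ℕ) : ℝ) * (TT j n f 1 / ((n : ℝ) + 1) ^ (k + 1)) := by
  have hn' : (0 : ℝ) < n := by exact_mod_cast hn
  cases j with
  | zero => simp [TT, hd, extFun, div_pow]; field_simp
  | succ j =>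
    simp only [TT]
    rw [Fin.prod_univ_succ, Fin.prod_univ_succ, Fin.prod_univ_succ (n := j)]
    have e : ∀ i : ℕ, ((n + 1 : ℕ) : ℝ) + 1 - ((i + 1 + 1 : ℕ) : ℝ) = (n : ℝ) + 1 - ((i + 1 : ℕ) : ℝ) := by
      intro i; push_cast; ring
    have e2 : ∀ i : ℕ, ((n + 1 : ℕ) : ℝ) - ((i + 1 + 1 : ℕ) : ℝ) = (n : ℝ) - ((i + 1 : ℕ) : ℝ) := by
      intro i; push_cast; ring
    simp only [extFun, hd, Fin.val_succ, Fin.val_zero, Fin.cons_zero, Fin.cons_succ, e, e2,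
      if_true, Nat.succ_ne_zero, if_false]
    have h0 : (0 : ℝ) < f.1 0 := by exact_mod_cast f.2.2 0
    have h1 : (0 : ℝ) < ((f.1 0 + k + 1 : ℕ) : ℝ) := by positivity
    have e3 : ((n + 1 : ℕ) : ℝ) + 1 - ((0 + 1 : ℕ) : ℝ) = (n : ℝ) + 1 := by push_cast; ring
    have e4 : ((n + 1 : ℕ) : ℝ) - ((0 + 1 : ℕ) : ℝ) = (n : ℝ) := by push_cast; ring
    have e5 : ((n + 1 : ℕ) : ℝ) = (n : ℝ) + 1 := by push_cast; ring
    rw [e3, e4, e5]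
    simp only [div_pow, one_pow]
    have : ((n : ℝ) + 1) ^ (f.1 0 + k + 1) = ((n : ℝ) + 1) ^ (f.1 0) * ((n : ℝ) + 1) ^ (k + 1) := by
      rw [← pow_add]; ring
    rw [this]
    field_simp

theorem TT_nonneg (j n : ℕ) (hj : j ≤ n) (f : TA j) (y : ℝ) (hy : 0 ≤ y) : 0 ≤ TT j n f y := by
  apply Finset.prod_nonneg
  intro i _
  have hi : (i : ℝ) ≤ n := by exact_mod_cast i.2.le.trans hj
  have : 0 ≤ (n : ℝ) + 1 - (i : ℕ) := by linarith
  have : 0 ≤ (n : ℝ) - (i : ℕ) := by linarith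
  split_ifs <;> positivity

theorem TT_le (j n : ℕ) (hj : j ≤ n) (f : TA j) (y : ℝ) (hy : 0 ≤ y) (hy1 : y ≤ 1) :
    TT j n f y ≤ TT j n f 1 := by
  rw [TT_pow]
  exact mul_le_of_le_one_left (TT_nonneg j n hj f 1 zero_le_one) (pow_le_one₀ hy hy1)

theorem TT_cont (j n : ℕ) (f : TA j) : Continuous (TT j n f) := by
  have : TT j n f = fun y => y ^ hd j f * TT j n f 1 := funext (TT_pow j n f)
  rw [this]; fun_prop

theorem summable_y (j n : ℕ) (hj : j ≤ n) (hs : Summable fun f => TT j n f 1)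
    (y : ℝ) (hy : 0 ≤ y) (hy1 : y ≤ 1) : Summable fun f => TT j n f y :=
  hs.of_nonneg_of_le (fun f => TT_nonneg j n hj f y hy) (fun f => TT_le j n hj f y hy hy1)

theorem M_cont (j n : ℕ) (hj : j ≤ n) (hs : Summable fun f => TT j n f 1) :
    ContinuousOn (M j n) (Set.Icc 0 1) := by
  change ContinuousOn (fun y => ∑' f, TT j n f y) _
  refine continuousOn_tsum (fun f => (TT_cont j n f).continuousOn) hs ?_
  intro f y hy
  rw [Real.norm_of_nonneg (TT_nonneg j n hj f y hy.1)]
  exact TT_le j n hj f y hy.1 hy.2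

theorem step (j n : ℕ) (hj : j < n) (hs : Summable fun f => TT j n f 1)
    (y : ℝ) (hy : 0 ≤ y) (hy1 : y ≤ 1) :
    HasSum (fun f => TT (j + 1) (n + 1) f y) (∫ t in (0 : ℝ)..y, M j n t / ((n : ℝ) + 1 - t)) := by
  have hn' : (1 : ℝ) ≤ n := by exact_mod_cast (by omega : 1 ≤ n)
  rw [← (Equiv.ofBijective _ (extFun_bij j)).hasSum_iff]
  have geo : ∀ t : ℝ, 0 ≤ t → t ≤ 1 →
      HasSum (fun k : ℕ => t ^ k / ((n : ℝ) + 1) ^ (k + 1)) (1 / ((n : ℝ) + 1 - t)) := by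
    intro t h0 h1
    have h := (hasSum_geometric_of_lt_one (r := t / ((n : ℝ) + 1)) (by positivity)
      (by rw [div_lt_one (by positivity)]; linarith)).div_const ((n : ℝ) + 1)
    have e1 : (fun k : ℕ => t ^ k / ((n : ℝ) + 1) ^ (k + 1)) =
        fun k => (t / ((n : ℝ) + 1)) ^ k / ((n : ℝ) + 1) := by
      funext k; rw [div_pow, pow_succ]; field_simp
    have e2 : 1 / ((n : ℝ) + 1 - t) = (1 - t / ((n : ℝ) + 1))⁻¹ / ((n : ℝ) + 1) := by
      have : (n : ℝ) + 1 - t ≠ 0 := by linarith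
      have h3 : (1 - t / ((n : ℝ) + 1)) = ((n : ℝ) + 1 - t) / ((n : ℝ) + 1) := by field_simp
      rw [h3]; field_simp
    rw [e1, e2]
    exact h
  have hprod : ∀ t : ℝ, 0 ≤ t → t ≤ 1 →
      Summable (fun p : TA j × ℕ => TT j n p.1 t * (t ^ p.2 / ((n : ℝ) + 1) ^ (p.2 + 1))) := by
    intro t h0 h1
    exact (summable_y j n hj.le hs t h0 h1).mul_of_nonneg (geo t h0 h1).summable
      (fun f => TT_nonneg j n hj.le f t h0) (fun k => by positivity)
  have key := intervalIntegral.hasSum_integral_of_dominated_convergence (a := 0) (b := y)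
    (μ := MeasureTheory.volume)
    (F := fun (p : TA j × ℕ) (t : ℝ) => TT j n p.1 t * (t ^ p.2 / ((n : ℝ) + 1) ^ (p.2 + 1)))
    (f := fun t => M j n t / ((n : ℝ) + 1 - t))
    (fun p _ => TT j n p.1 1 * (1 ^ p.2 / ((n : ℝ) + 1) ^ (p.2 + 1)))
    (fun p => by
      have := TT_cont j n p.1
      exact Continuous.aestronglyMeasurable (by fun_prop))
    (fun p => by
      refine Filter.Eventually.of_forall fun t ht => ?_
      rw [Set.uIoc_of_le hy] at ht
      have h0 := ht.1.le
      have h1 := ht.2.trans hy1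
      rw [Real.norm_of_nonneg (mul_nonneg (TT_nonneg j n hj.le p.1 t h0) (by positivity))]
      have := TT_nonneg j n hj.le p.1 1 zero_le_one
      have := TT_le j n hj.le p.1 t h0 h1
      gcongr)
    (Filter.Eventually.of_forall fun t _ => hprod 1 zero_le_one le_rfl)
    (by simp)
    (by
      refine Filter.Eventually.of_forall fun t ht => ?_
      rw [Set.uIoc_of_le hy] at ht
      have h0 := ht.1.le
      have h1 := ht.2.trans hy1
      have hm : HasSum (fun f => TT j n f t) (M j n t) := (summable_y j n hj.le hs t h0 h1).hasSum
      have := hm.mul (geo t h0 h1) (hprod t h0 h1)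
      rwa [mul_one_div] at this)
  refine (congrArg (fun F => HasSum F _) (funext ?_)).mpr key
  intro p
  obtain ⟨f, k⟩ := p
  simp only [Function.comp, Equiv.ofBijective_apply]
  rw [TT_ext j n (by omega)]
  have : ∀ t : ℝ, TT j n f t * (t ^ k / ((n : ℝ) + 1) ^ (k + 1)) =
      t ^ (hd j f + k) * (TT j n f 1 / ((n : ℝ) + 1) ^ (k + 1)) := by
    intro t; rw [TT_pow, pow_add]; ring
  simp only [this]
  rw [intervalIntegral.integral_mul_const, integral_pow]
  simp

theorem summ (j : ℕ) : ∀ n, j < n → Summable fun f => TT j n f 1 := by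
  induction j with
  | zero =>
    intro n _
    have : Finite (TA 0) := inferInstance
    exact Summable.of_finite
  | succ j ih =>
    intro n hn
    obtain ⟨n, rfl⟩ : ∃ m, n = m + 1 := ⟨n - 1, by omega⟩
    exact (step j n (by omega) (ih n (by omega)) 1 zero_le_one le_rfl).summable

theorem M_succ (j n : ℕ) (hj : j < n) (y : ℝ) (hy : 0 ≤ y) (hy1 : y ≤ 1) :
    M (j + 1) (n + 1) y = ∫ t in (0 : ℝ)..y, M j n t / ((n : ℝ) + 1 - t) :=
  (step j n hj (summ j n hj) y hy hy1).tsum_eq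

theorem M_zero (n : ℕ) (y : ℝ) : M 0 n y = 1 := by
  have e : ∀ f : TA 0, TT 0 n f y = 1 := fun f => by simp [TT]
  change ∑' f, TT 0 n f y = 1
  simp only [e]
  have : Unique (TA 0) := ⟨⟨⟨Fin.elim0, fun a => a.elim0, fun a => a.elim0⟩⟩,
    fun f => Subtype.ext (funext fun i => i.elim0)⟩
  simp

theorem mainR (σ : ℝ → ℝ)
    (hσcont : ContinuousOn σ (Set.Ici 0))
    (hσinit : ∀ u : ℝ, 0 ≤ u → u ≤ 1 → σ u = 1)
    (hσderiv : ∀ u : ℝ, 1 < u → HasDerivAt σ (σ (u - 1) / u) u)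
    (n : ℕ) : ∀ (y : ℝ) (_ : 0 ≤ y) (_ : y ≤ 1),
    σ (((n + 1 : ℕ) : ℝ) - y) =
      ∑ j ∈ Finset.range (n + 1), (-1 : ℝ) ^ j * σ (((n + 1 : ℕ) : ℝ) - (j : ℝ)) * M j (n + 1) y := by
  induction n with
  | zero =>
    intro y h0 h1
    simp [M_zero]
    rw [hσinit _ (by linarith) (by linarith), hσinit _ (by norm_num) (by norm_num)]
  | succ n ih =>
    intro y h0 h1
    rw [Finset.sum_range_succ']
    have hc : ((n + 1 + 1 : ℕ) : ℝ) = ((n + 1 : ℕ) : ℝ) + 1 := by push_cast; ring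
    have hN : (1 : ℝ) ≤ ((n + 1 : ℕ) : ℝ) := by push_cast; linarith [Nat.cast_nonneg (α := ℝ) n]
    have hco : ContinuousOn (fun t : ℝ => σ (((n + 1 + 1 : ℕ) : ℝ) - t)) (Set.Icc 0 y) := by
      refine hσcont.comp (by fun_prop) ?_
      intro t ht
      simp only [Set.mem_Ici]; linarith [ht.2]
    have hco2 : ContinuousOn (fun t : ℝ => σ (((n + 1 : ℕ) : ℝ) - t)) (Set.Icc 0 y) := by
      refine hσcont.comp (by fun_prop) ?_
      intro t ht
      simp only [Set.mem_Ici]; linarith [ht.2]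
    have hden : ∀ t ∈ Set.Icc 0 y, ((n + 1 : ℕ) : ℝ) + 1 - t ≠ 0 := by
      intro t ht
      have := ht.2
      linarith
    have ftc := intervalIntegral.integral_eq_sub_of_hasDerivAt_of_le
      (f := fun t : ℝ => σ (((n + 1 + 1 : ℕ) : ℝ) - t))
      (f' := fun t : ℝ => -(σ (((n + 1 : ℕ) : ℝ) - t) / (((n + 1 : ℕ) : ℝ) + 1 - t))) h0 hco
      (by
        intro t ht
        have h := hσderiv (((n + 1 + 1 : ℕ) : ℝ) - t) (by linarith [ht.2])
        have h2 := h.comp t ((hasDerivAt_id t).const_sub _)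
        refine HasDerivAt.congr_deriv h2 ?_
        rw [hc]
        rw [show ((n + 1 : ℕ) : ℝ) + 1 - t - 1 = ((n + 1 : ℕ) : ℝ) - t by ring]
        ring)
      (by
        apply ContinuousOn.intervalIntegrable
        rw [Set.uIcc_of_le h0]
        exact (hco2.div (by fun_prop) hden).neg)
    have hint : ∀ j ∈ Finset.range (n + 1), IntervalIntegrable
        (fun t => ((-1 : ℝ) ^ (j + 1) * σ (((n + 1 : ℕ) : ℝ) - (j : ℝ))) *
          (M j (n + 1) t / (((n + 1 : ℕ) : ℝ) + 1 - t))) MeasureTheory.volume 0 y := by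
      intro j hj
      have hj := Finset.mem_range.mp hj
      apply ContinuousOn.intervalIntegrable
      rw [Set.uIcc_of_le h0]
      refine continuousOn_const.mul (ContinuousOn.div ?_ (by fun_prop) hden)
      exact (M_cont j (n + 1) hj.le (summ j (n + 1) hj)).mono (Set.Icc_subset_Icc_right h1)
    have heq : (∫ t in (0 : ℝ)..y, -(σ (((n + 1 : ℕ) : ℝ) - t) / (((n + 1 : ℕ) : ℝ) + 1 - t))) =
        ∫ t in (0 : ℝ)..y, ∑ j ∈ Finset.range (n + 1),
          ((-1 : ℝ) ^ (j + 1) * σ (((n + 1 : ℕ) : ℝ) - (j : ℝ))) *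
          (M j (n + 1) t / (((n + 1 : ℕ) : ℝ) + 1 - t)) := by
      apply intervalIntegral.integral_congr
      intro t ht
      rw [Set.uIcc_of_le h0] at ht
      simp only
      rw [ih t ht.1 (ht.2.trans h1), Finset.sum_div, ← Finset.sum_neg_distrib]
      refine Finset.sum_congr rfl fun j _ => ?_
      ring
    rw [heq, intervalIntegral.integral_finsetSum hint] at ftc
    simp only [intervalIntegral.integral_const_mul, sub_zero] at ftc
    rw [eq_comm, sub_eq_iff_eq_add] at ftc
    rw [ftc]
    congr 1
    · refine Finset.sum_congr rfl fun j hj => ?_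
      rw [M_succ j (n + 1) (Finset.mem_range.mp hj) y h0 h1]
      congr 3
      push_cast; ring
    · simp [M_zero]

/-- Theorem 2: For every real `y ∈ [0,1]` and every positive integer `n`,
the function `σ` (with `σ(u) = 1` on `[0,1]` and `u·σ′(u) = σ(u−1)` for `u > 1`)
satisfies `σ(n−y) = σ(n) + ∑_{j=1}^{n−1} (−1)^j·σ(n−j)·M_{j,n}(y)`. -/
theorem buchstab_polylog_expansion
    (σ : ℝ → ℝ)
    (hσcont : ContinuousOn σ (Set.Ici 0))
    (hσinit : ∀ u : ℝ, 0 ≤ u → u ≤ 1 → σ u = 1)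
    (hσderiv : ∀ u : ℝ, 1 < u → HasDerivAt σ (σ (u - 1) / u) u)
    (n : ℕ) (hn : 0 < n) (y : ℝ) (hy0 : 0 ≤ y) (hy1 : y ≤ 1) :
    σ ((n : ℝ) - y) = σ (n : ℝ)
      + ∑ j ∈ Finset.Icc 1 (n - 1), (-1 : ℝ) ^ j * σ ((n : ℝ) - (j : ℝ)) * M j n y := by
  obtain ⟨m, rfl⟩ : ∃ m, n = m + 1 := ⟨n - 1, by omega⟩
  rw [mainR σ hσcont hσinit hσderiv m y hy0 hy1, Finset.sum_range_succ']
  rw [add_comm]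
  congr 1
  · simp [M_zero]
  · rw [Nat.add_sub_cancel, Finset.sum_bij (fun j _ => j + 1)]
    · intro j hj
      have := Finset.mem_range.mp hj
      exact Finset.mem_Icc.mpr ⟨by omega, by omega⟩
    · intro a _ b _ h
      omega
    · intro b hb
      have := Finset.mem_Icc.mp hb
      exact ⟨b - 1, Finset.mem_range.mpr (by omega), by omega⟩
    · intro j _
      rfl
end

section
/- (Theorem 4) For every real u ≥ 3, the Furry probability of weight three satisfies P_3(u) = (1/2)·Li_3(1/(u(2−u))) − Li_3(1/u) − Li_3(1/(2−u)) + Li_2(1/u)·log(u−2) + (1/3)ζ(3) − (1/2)ζ(2)·log(u) + (1/12)·log³(u(u−2)) − (1/2)·log²(u−2)·log(u). -/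
/-- The classical polylogarithm `Li_k(z) = ∑_{n≥1} z^n/n^k`. -/
noncomputable def Li (k : ℕ) (z : ℝ) : ℝ :=
  ∑' n : ℕ, z ^ (n + 1) / ((n : ℝ) + 1) ^ k

/-- `ζ_k = Li_k(1)`. -/
noncomputable def zeta' (k : ℕ) : ℝ := Li k 1

lemma Li_term_bound (k n : ℕ) (hk : 2 ≤ k) (z : ℝ) (hz : |z| ≤ 1) :
    ‖z ^ (n + 1) / ((n : ℝ) + 1) ^ k‖ ≤ 1 / ((n : ℝ) + 1) ^ 2 := by
  have h1 : (1 : ℝ) ≤ (n : ℝ) + 1 := by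
    have := Nat.cast_nonneg (α := ℝ) n
    linarith
  rw [norm_div, norm_pow, norm_pow, Real.norm_eq_abs, Real.norm_eq_abs, abs_of_pos (by linarith : (0 : ℝ) < (n : ℝ) + 1)]
  apply div_le_div₀ zero_le_one (pow_le_one₀ (abs_nonneg _) hz) (by positivity)
  exact pow_le_pow_right₀ h1 hk

lemma summable_sq : Summable (fun n : ℕ => 1 / ((n : ℝ) + 1) ^ 2) := by
  have h := (summable_nat_add_iff 1).2 (Real.summable_one_div_nat_pow.2 (by norm_num : 1 < 2))
  simpa using h

lemma Li_summable (k : ℕ) (hk : 2 ≤ k) (z : ℝ) (hz : |z| ≤ 1) :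
    Summable (fun n : ℕ => z ^ (n + 1) / ((n : ℝ) + 1) ^ k) :=
  Summable.of_norm_bounded summable_sq (fun n => Li_term_bound k n hk z hz)

lemma Li_cont (k : ℕ) (hk : 2 ≤ k) : ContinuousOn (Li k) (Set.Icc (-1) 1) := by
  unfold Li
  apply continuousOn_tsum (u := fun n : ℕ => 1 / ((n : ℝ) + 1) ^ 2)
  · intro n
    fun_prop
  · exact summable_sq
  · intro n x hx
    exact Li_term_bound k n hk x (abs_le.2 hx)

lemma Li_comp_cont (k : ℕ) (hk : 2 ≤ k) {f : ℝ → ℝ} {s : Set ℝ} (hf : ContinuousOn f s)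
    (h : ∀ x ∈ s, -1 ≤ f x ∧ f x ≤ 1) : ContinuousOn (fun x => Li k (f x)) s :=
  (Li_cont k hk).comp hf (fun x hx => h x hx)

lemma Li_zero (k : ℕ) : Li k 0 = 0 := by simp [Li]

lemma Li_one (z : ℝ) (hz : |z| < 1) : Li 1 z = - Real.log (1 - z) := by
  have := (Real.hasSum_pow_div_log_of_abs_lt_one hz).tsum_eq
  simpa [Li] using this

lemma Li_deriv (k : ℕ) (z : ℝ) (hz : |z| < 1) (h0 : z ≠ 0) :
    HasDerivAt (Li (k + 1)) (Li k z / z) z := by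
  obtain ⟨r, hr1, hr2⟩ := exists_between hz
  have hr0 : 0 ≤ r := le_trans (abs_nonneg z) hr1.le
  have key : HasDerivAt (fun y : ℝ => ∑' n : ℕ, y ^ (n + 1) / ((n : ℝ) + 1) ^ (k + 1))
      (∑' n : ℕ, z ^ n / ((n : ℝ) + 1) ^ k) z := by
    apply hasDerivAt_tsum_of_isPreconnected (u := fun n : ℕ => r ^ n)
      (t := Metric.ball (0 : ℝ) r) (y₀ := 0)
      (g := fun (n : ℕ) (y : ℝ) => y ^ (n + 1) / ((n : ℝ) + 1) ^ (k + 1))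
      (g' := fun (n : ℕ) (y : ℝ) => y ^ n / ((n : ℝ) + 1) ^ k)
    · exact summable_geometric_of_lt_one hr0 hr2
    · exact Metric.isOpen_ball
    · exact (convex_ball _ _).isPreconnected
    · intro n y hy
      have := (hasDerivAt_pow (n + 1) y).div_const (((n : ℝ) + 1) ^ (k + 1))
      refine this.congr_deriv ?_
      have : (n : ℝ) + 1 ≠ 0 := by positivity
      push_cast
      field_simp
      ring
    · intro n y hy
      have hy' : |y| < r := by simpa using hy
      have h1 : (1 : ℝ) ≤ (n : ℝ) + 1 := by
        have := Nat.cast_nonneg (α := ℝ) n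
        linarith
      rw [norm_div, norm_pow, norm_pow, Real.norm_eq_abs, Real.norm_eq_abs,
        abs_of_pos (by linarith : (0 : ℝ) < (n : ℝ) + 1)]
      refine (div_le_self (by positivity) (one_le_pow₀ h1)).trans ?_
      exact pow_le_pow_left₀ (abs_nonneg _) hy'.le n
    · simpa using lt_of_le_of_lt (abs_nonneg z) hr1
    · simp
    · simpa using hr1
  refine key.congr_deriv ?_
  unfold Li
  symm
  rw [← tsum_div_const]
  congr 1
  ext n
  field_simp
  ring

lemma Li2_deriv (z : ℝ) (hz : |z| < 1) (h0 : z ≠ 0) :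
    HasDerivAt (Li 2) (- Real.log (1 - z) / z) z := by
  have := Li_deriv 1 z hz h0
  rwa [Li_one z hz] at this

lemma Li2_comp {f : ℝ → ℝ} {f' x : ℝ} (hf : HasDerivAt f f' x) (h1 : -1 < f x) (h2 : f x < 1)
    (h0 : f x ≠ 0) :
    HasDerivAt (fun y => Li 2 (f y)) (- Real.log (1 - f x) / f x * f') x :=
  (Li2_deriv (f x) (abs_lt.2 ⟨h1, h2⟩) h0).comp x hf

lemma Li3_comp {f : ℝ → ℝ} {f' x : ℝ} (hf : HasDerivAt f f' x) (h1 : -1 < f x) (h2 : f x < 1)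
    (h0 : f x ≠ 0) :
    HasDerivAt (fun y => Li 3 (f y)) (Li 2 (f x) / f x * f') x :=
  (Li_deriv 2 (f x) (abs_lt.2 ⟨h1, h2⟩) h0).comp x hf

lemma Li_dup (k : ℕ) (hk : 2 ≤ k) (z : ℝ) (hz : |z| ≤ 1) :
    Li k z + Li k (-z) = 2 / 2 ^ k * Li k (z ^ 2) := by
  have s1 := Li_summable k hk z hz
  have s2 := Li_summable k hk (-z) (by simpa using hz)
  unfold Li
  rw [← s1.tsum_add s2]
  have s := s1.add s2
  have e1 : ∀ n : ℕ, z ^ (2 * n + 1) / (((2 * n : ℕ) : ℝ) + 1) ^ k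
      + (-z) ^ (2 * n + 1) / (((2 * n : ℕ) : ℝ) + 1) ^ k = 0 := by
    intro n
    rw [Odd.neg_pow ⟨n, rfl⟩]
    ring
  have e2 : ∀ n : ℕ, z ^ (2 * n + 1 + 1) / (((2 * n + 1 : ℕ) : ℝ) + 1) ^ k
      + (-z) ^ (2 * n + 1 + 1) / (((2 * n + 1 : ℕ) : ℝ) + 1) ^ k
      = 2 / 2 ^ k * ((z ^ 2) ^ (n + 1) / ((n : ℝ) + 1) ^ k) := by
    intro n
    rw [Even.neg_pow ⟨n + 1, by ring⟩]
    have : (((2 * n + 1 : ℕ) : ℝ) + 1) = 2 * ((n : ℝ) + 1) := by push_cast; ring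
    rw [this, mul_pow, ← pow_mul]
    have : (n : ℝ) + 1 ≠ 0 := by positivity
    field_simp
    ring
  rw [← tsum_even_add_odd (f := fun n : ℕ => z ^ (n + 1) / ((n : ℝ) + 1) ^ k
      + (-z) ^ (n + 1) / ((n : ℝ) + 1) ^ k)
      (s.comp_injective (i := fun n : ℕ => 2 * n) (fun a b h => by simpa using h))
      (s.comp_injective (i := fun n : ℕ => 2 * n + 1) (fun a b h => by simpa using h))]
  simp only [e1, e2, tsum_zero, zero_add, tsum_mul_left]

lemma const_of {g g' : ℝ → ℝ} {a b : ℝ} (hab : a ≤ b) (hc : ContinuousOn g (Set.Icc a b))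
    (hd : ∀ x, a < x → x < b → HasDerivAt g (g' x) x) (h0 : ∀ x, a < x → x < b → g' x = 0) :
    g b = g a := by
  rcases hab.eq_or_lt with h | h
  · rw [h]
  · obtain ⟨c, hc1, hc2⟩ := exists_hasDerivAt_eq_slope g g' h hc (fun x hx => hd x hx.1 hx.2)
    rw [h0 c hc1.1 hc1.2] at hc2
    have : b - a ≠ 0 := by linarith
    field_simp at hc2
    linarith

lemma Landen_fun_deriv (z : ℝ) (h1 : -1 < z) (h2 : z < 1 / 2) (h0 : z ≠ 0) :
    HasDerivAt (fun z => Li 2 z + Li 2 (z / (z - 1)) + 1 / 2 * Real.log (1 - z) ^ 2) 0 z := by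
  have hz1 : z - 1 < 0 := by linarith
  have hz1' : z - 1 ≠ 0 := hz1.ne
  have hz2' : 1 - z ≠ 0 := by linarith
  have d1 := Li2_deriv z (abs_lt.2 ⟨h1, by linarith⟩) h0
  have d2 := Li2_comp (f := fun z => z / (z - 1)) ((hasDerivAt_id' z).div ((hasDerivAt_id' z).sub_const 1) hz1')
    (by rw [lt_div_iff_of_neg hz1]; linarith) (by rw [div_lt_iff_of_neg hz1]; linarith)
    (div_ne_zero h0 hz1')
  have d3 := ((((hasDerivAt_id' z).const_sub 1).log hz2').fun_pow 2).const_mul (1 / 2 : ℝ)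
  refine ((d1.fun_add d2).fun_add d3).congr_deriv ?_
  have e : 1 - z / (z - 1) = (1 - z)⁻¹ := by
    apply eq_inv_of_mul_eq_one_left
    field_simp
    ring
  rw [e, Real.log_inv]
  push_cast
  field_simp
  ring

lemma Landen2 (z : ℝ) (h1 : -1 ≤ z) (h2 : z ≤ 1 / 2) :
    Li 2 z + Li 2 (z / (z - 1)) = - (1 / 2) * Real.log (1 - z) ^ 2 := by
  have hc : ContinuousOn (fun z => Li 2 z + Li 2 (z / (z - 1)) + 1 / 2 * Real.log (1 - z) ^ 2)
      (Set.Icc (-1) (1 / 2)) := by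
    apply ContinuousOn.add
    · apply ContinuousOn.add
      · exact (Li_cont 2 le_rfl).mono (Set.Icc_subset_Icc le_rfl (by norm_num))
      · apply Li_comp_cont 2 le_rfl
        · apply ContinuousOn.div (by fun_prop) (by fun_prop)
          intro x hx
          have := hx.2
          linarith
        · intro x hx
          have hx1 := hx.1
          have hx2 := hx.2
          have : x - 1 < 0 := by linarith
          constructor
          · rw [le_div_iff_of_neg this]; linarith
          · rw [div_le_iff_of_neg this]; linarith
    · apply ContinuousOn.mul continuousOn_const
      apply ContinuousOn.pow
      apply ContinuousOn.log (by fun_prop)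
      intro x hx
      have := hx.2
      linarith
  have hz : (fun z => Li 2 z + Li 2 (z / (z - 1)) + 1 / 2 * Real.log (1 - z) ^ 2) z =
    (fun z => Li 2 z + Li 2 (z / (z - 1)) + 1 / 2 * Real.log (1 - z) ^ 2) 0 := by
    rcases le_total z 0 with h | h
    · exact (const_of (g' := fun _ => 0) h (hc.mono (Set.Icc_subset_Icc h1 (by norm_num)))
        (fun x a b => Landen_fun_deriv x (by linarith) (by linarith) b.ne) (fun _ _ _ => rfl)).symm
    · exact (const_of (g' := fun _ => 0) h (hc.mono (Set.Icc_subset_Icc (by norm_num) h2))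
        (fun x a b => Landen_fun_deriv x (by linarith) (by linarith) a.ne') (fun _ _ _ => rfl))
  simp [Li_zero] at hz
  linarith

lemma Li_neg_one_2 : Li 2 (-1) = - (1 / 2) * zeta' 2 := by
  have := Li_dup 2 le_rfl 1 (by simp)
  norm_num at this
  unfold zeta'
  linarith

lemma Li_neg_one_3 : Li 3 (-1) = - (3 / 4) * zeta' 3 := by
  have := Li_dup 3 (by norm_num) 1 (by simp)
  norm_num at this
  unfold zeta'
  linarith

lemma loglog_cont (z : ℝ) (hz : 0 < z) (hz1 : z ≤ 1) :
    ContinuousAt (fun z : ℝ => Real.log z * Real.log (1 - z)) z := by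
  rcases hz1.eq_or_lt with rfl | h
  · have hb : ∀ᶠ y : ℝ in nhds 1, ‖Real.log y * Real.log (1 - y)‖ ≤
        2 * |(1 - y) * Real.log (1 - y)| := by
      filter_upwards [lt_mem_nhds (by norm_num : (1 / 2 : ℝ) < 1)] with y hy
      rw [norm_mul, abs_mul, ← mul_assoc]
      apply mul_le_mul_of_nonneg_right _ (norm_nonneg _)
      have y0 : 0 < y := by linarith
      have a1 := Real.log_le_sub_one_of_pos y0
      have a2 := Real.one_sub_inv_le_log_of_pos y0
      have a3 : 1 - y⁻¹ = (y - 1) * y⁻¹ := by field_simp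
      have a4 : y⁻¹ ≤ 2 := by
        rw [inv_le_comm₀ y0 (by norm_num)]
        linarith
      have a5 : 0 < y⁻¹ := by positivity
      rw [Real.norm_eq_abs, abs_le]
      rcases abs_cases (1 - y) with ⟨e, h⟩ | ⟨e, h⟩ <;> rw [e] <;> constructor <;> nlinarith
    have hl : Filter.Tendsto (fun y : ℝ => 2 * |(1 - y) * Real.log (1 - y)|) (nhds 1) (nhds 0) := by
      have hc : Continuous (fun y : ℝ => 2 * |(1 - y) * Real.log (1 - y)|) := by
        have := Real.continuous_mul_log.comp (continuous_const.sub continuous_id : Continuous (fun y : ℝ => 1 - y))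
        exact continuous_const.mul this.abs
      have := hc.tendsto 1
      simpa using this
    have := squeeze_zero_norm' hb hl
    simpa [ContinuousAt] using this
  · have : 1 - z ≠ 0 := by linarith
    have := hz.ne'
    fun_prop (disch := assumption)

lemma reflect_half (z : ℝ) (h1 : 1 / 2 ≤ z) (h2 : z ≤ 1) :
    Li 2 z + Li 2 (1 - z) + Real.log z * Real.log (1 - z) = zeta' 2 := by
  have := const_of (g := fun z => Li 2 z + Li 2 (1 - z) + Real.log z * Real.log (1 - z))
    (g' := fun _ => 0) h2 ?_ ?_ (fun _ _ _ => rfl)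
  · simp [Li_zero] at this
    rw [zeta']
    exact this.symm
  · apply ContinuousOn.add
    · apply ContinuousOn.add
      · exact (Li_cont 2 le_rfl).mono (Set.Icc_subset_Icc (by linarith) le_rfl)
      · apply Li_comp_cont 2 le_rfl (by fun_prop)
        intro x hx
        have a1 := hx.1
        have a2 := hx.2
        constructor <;> linarith
    · intro x hx
      exact (loglog_cont x (by linarith [hx.1]) hx.2).continuousWithinAt
  · intro x a b
    have hx : x ≠ 0 := by linarith
    have hx1 : 1 - x ≠ 0 := by linarith
    have d1 := Li2_deriv x (abs_lt.2 ⟨by linarith, b⟩) hx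
    have d2 := Li2_comp (f := fun x => 1 - x) ((hasDerivAt_id' x).const_sub 1)
      (by linarith) (by linarith) hx1
    have d3 := (Real.hasDerivAt_log hx).fun_mul (((hasDerivAt_id' x).const_sub 1).log hx1)
    refine ((d1.fun_add d2).fun_add d3).congr_deriv ?_
    rw [sub_sub_cancel]
    field_simp
    ring

lemma Landen3 (z : ℝ) (h1 : 1 / 2 ≤ z) (h2 : z ≤ 1) :
    Li 3 z + Li 3 (1 - z) + Li 3 (1 - 1 / z) = zeta' 3 + Real.log z ^ 3 / 6
      + zeta' 2 * Real.log z - 1 / 2 * (Real.log z * (Real.log z * Real.log (1 - z))) := by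
  have := const_of (g := fun z => Li 3 z + Li 3 (1 - z) + Li 3 (1 - 1 / z)
      - (Real.log z ^ 3 * (1 / 6)
      + zeta' 2 * Real.log z - 1 / 2 * (Real.log z * (Real.log z * Real.log (1 - z)))))
    (g' := fun _ => 0) h2 ?_ ?_ (fun _ _ _ => rfl)
  · simp [Li_zero] at this
    rw [← zeta'] at this
    simp only [one_div]
    linarith
  · have hlog : ContinuousOn Real.log (Set.Icc z 1) := by
      apply ContinuousOn.log continuousOn_id
      intro x hx
      have := hx.1
      simp only [id]
      linarith
    apply ContinuousOn.sub
    · apply ContinuousOn.add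
      · apply ContinuousOn.add
        · exact (Li_cont 3 (by norm_num)).mono (Set.Icc_subset_Icc (by linarith) le_rfl)
        · apply Li_comp_cont 3 (by norm_num) (by fun_prop)
          intro x hx
          have a1 := hx.1
          have a2 := hx.2
          constructor <;> linarith
      · apply Li_comp_cont 3 (by norm_num)
        · apply ContinuousOn.sub continuousOn_const
          apply ContinuousOn.div continuousOn_const continuousOn_id
          intro x hx
          have := hx.1
          simp only [id]
          linarith
        · intro x hx
          have a1 := hx.1
          have a2 := hx.2
          have x0 : 0 < x := by linarith
          have : 1 / x ≤ 2 := by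
            rw [div_le_iff₀ x0]
            linarith
          have : 0 < 1 / x := by positivity
          constructor <;> linarith
    · apply ContinuousOn.sub
      · fun_prop
      · apply ContinuousOn.mul continuousOn_const
        apply ContinuousOn.mul hlog
        intro x hx
        exact (loglog_cont x (by linarith [hx.1]) hx.2).continuousWithinAt
  · intro x a b
    have x0 : 0 < x := by linarith
    have hx : x ≠ 0 := by linarith
    have hx1 : 1 - x ≠ 0 := by linarith
    have hx1' : x - 1 ≠ 0 := by linarith
    have q1 : 1 / x < 2 := by
      rw [div_lt_iff₀ x0]
      linarith
    have q2 : 1 < 1 / x := by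
      rw [lt_div_iff₀ x0]
      linarith
    have d1 := Li3_comp (hasDerivAt_id' x) (by linarith) b hx
    have d2 := Li3_comp (f := fun x => 1 - x) ((hasDerivAt_id' x).const_sub 1)
      (by linarith) (by linarith) hx1
    have d3 := Li3_comp (f := fun x => 1 - 1 / x) (((hasDerivAt_const x 1).div (hasDerivAt_id' x) hx).const_sub 1)
      (by linarith) (by linarith) (by linarith)
    have l1 := Real.hasDerivAt_log hx
    have l2 := ((hasDerivAt_id' x).const_sub 1).log hx1
    have d4 := (((l1.fun_pow 3).mul_const (1 / 6 : ℝ)).fun_add (l1.const_mul (zeta' 2))).fun_sub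
      ((l1.fun_mul (l1.fun_mul l2)).const_mul (1 / 2 : ℝ))
    refine (((d1.fun_add d2).fun_add d3).fun_sub d4).congr_deriv ?_
    have R := reflect_half x (by linarith) b.le
    have L := Landen2 (1 - x) (by linarith) (by linarith)
    have e : (1 - x) / (1 - x - 1) = 1 - 1 / x := by
      have : 1 - x - 1 = - x := by ring
      rw [this]
      field_simp
      ring
    rw [e, sub_sub_cancel] at L
    have L' : Li 2 (1 - 1 / x) = - (1 / 2) * Real.log x ^ 2 - Li 2 (1 - x) := by linarith
    have R' : Li 2 x = zeta' 2 - Real.log x * Real.log (1 - x) - Li 2 (1 - x) := by linarith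
    rw [L', R']
    have e2 : 1 - 1 / x = (x - 1) / x := by field_simp
    rw [e2]
    have e3 : 1 - x = - (x - 1) := by ring
    generalize Li 2 (1 - x) = A
    generalize Real.log (1 - x) = B
    rw [e3]
    push_cast
    field_simp
    ring

lemma kum_bd (x : ℝ) (h1 : 0 ≤ x) (h2 : x ≤ 1) :
    0 ≤ (1 - x) / (1 + x) ∧ (1 - x) / (1 + x) ≤ 1 := by
  have : 0 < 1 + x := by linarith
  constructor
  · apply div_nonneg <;> linarith
  · rw [div_le_one this]
    linarith

lemma kum_bd' (x : ℝ) (h1 : 0 < x) (h2 : x < 1) :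
    0 < (1 - x) / (1 + x) ∧ (1 - x) / (1 + x) < 1 := by
  have : 0 < 1 + x := by linarith
  constructor
  · apply div_pos <;> linarith
  · rw [div_lt_one this]
    linarith

lemma kum_cont (z : ℝ) : ContinuousOn (fun x : ℝ => (1 - x) / (1 + x)) (Set.Icc 0 z) := by
  apply ContinuousOn.div (by fun_prop) (by fun_prop)
  intro x hx
  have := hx.1
  linarith

lemma kc1 (k : ℕ) (hk : 2 ≤ k) (z : ℝ) (hz : z ≤ 1) :
    ContinuousOn (fun x => Li k ((1 - x) / (1 + x))) (Set.Icc 0 z) := by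
  apply Li_comp_cont k hk (kum_cont z)
  intro x hx
  have := kum_bd x hx.1 (hx.2.trans hz)
  exact ⟨by linarith [this.1], this.2⟩

lemma kc2 (k : ℕ) (hk : 2 ≤ k) (z : ℝ) (hz : z ≤ 1) :
    ContinuousOn (fun x => Li k (-((1 - x) / (1 + x)))) (Set.Icc 0 z) := by
  apply Li_comp_cont k hk (kum_cont z).fun_neg
  intro x hx
  have := kum_bd x hx.1 (hx.2.trans hz)
  exact ⟨by linarith [this.2], by linarith [this.1]⟩

lemma kc3 (k : ℕ) (hk : 2 ≤ k) (z : ℝ) (hz : z ≤ 1) :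
    ContinuousOn (fun x => Li k (1 - x)) (Set.Icc 0 z) := by
  apply Li_comp_cont k hk (by fun_prop)
  intro x hx
  have a1 := hx.1
  have a2 := hx.2
  constructor <;> linarith

lemma kc4 (k : ℕ) (hk : 2 ≤ k) (z : ℝ) :
    ContinuousOn (fun x => Li k (1 / (1 + x))) (Set.Icc 0 z) := by
  apply Li_comp_cont k hk
  · apply ContinuousOn.div (by fun_prop) (by fun_prop)
    intro x hx
    have := hx.1
    linarith
  · intro x hx
    have a1 := hx.1
    have : 0 < 1 + x := by linarith
    constructor
    · have : 0 < 1 / (1 + x) := by positivity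
      linarith
    · rw [div_le_one this]
      linarith

lemma kc5 (k : ℕ) (hk : 2 ≤ k) (z : ℝ) (hz : z ≤ 1) :
    ContinuousOn (fun x => Li k (1 - x ^ 2)) (Set.Icc 0 z) := by
  apply Li_comp_cont k hk (by fun_prop)
  intro x hx
  have a1 := hx.1
  have a2 := hx.2
  constructor <;> nlinarith

lemma kc6 (z : ℝ) : ContinuousOn (fun x => Real.log (1 + x)) (Set.Icc 0 z) := by
  apply ContinuousOn.log (by fun_prop)
  intro x hx
  have a1 := hx.1
  linarith

lemma kum_deriv (x : ℝ) (h1 : 0 < x) : HasDerivAt (fun x : ℝ => (1 - x) / (1 + x))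
    (-2 / (1 + x) ^ 2) x := by
  have h : 1 + x ≠ 0 := by linarith
  refine (((hasDerivAt_id' x).const_sub 1).fun_div ((hasDerivAt_id' x).const_add 1) h).congr_deriv ?_
  field_simp
  ring

lemma kum4_deriv (x : ℝ) (h1 : 0 < x) : HasDerivAt (fun x : ℝ => 1 / (1 + x))
    (-1 / (1 + x) ^ 2) x := by
  have h : 1 + x ≠ 0 := by linarith
  refine ((hasDerivAt_const x 1).fun_div ((hasDerivAt_id' x).const_add 1) h).congr_deriv ?_
  field_simp
  ring

lemma kum5_deriv (x : ℝ) : HasDerivAt (fun x : ℝ => 1 - x ^ 2) (- (2 * x)) x := by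
  refine ((hasDerivAt_pow 2 x).const_sub 1).congr_deriv ?_
  simp

lemma kum_log1 (x : ℝ) (h1 : 0 < x) :
    Real.log (1 - (1 - x) / (1 + x)) = Real.log 2 + Real.log x - Real.log (1 + x) := by
  have h : 1 + x ≠ 0 := by linarith
  have : 1 - (1 - x) / (1 + x) = 2 * x / (1 + x) := by field_simp; ring
  rw [this, Real.log_div (by positivity) h, Real.log_mul (by norm_num) h1.ne']

lemma kum_log2 (x : ℝ) (h1 : 0 < x) :
    Real.log (1 - -((1 - x) / (1 + x))) = Real.log 2 - Real.log (1 + x) := by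
  have h : 1 + x ≠ 0 := by linarith
  have : 1 - -((1 - x) / (1 + x)) = 2 / (1 + x) := by field_simp; ring
  rw [this, Real.log_div (by positivity) h]

lemma kum_log4 (x : ℝ) (h1 : 0 < x) :
    Real.log (1 - 1 / (1 + x)) = Real.log x - Real.log (1 + x) := by
  have h : 1 + x ≠ 0 := by linarith
  have : 1 - 1 / (1 + x) = x / (1 + x) := by field_simp; ring
  rw [this, Real.log_div (by positivity) h]

lemma kum_log5 (x : ℝ) : Real.log (1 - (1 - x ^ 2)) = 2 * Real.log x := by
  rw [sub_sub_cancel, Real.log_pow]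
  norm_num

lemma kumB1 (z : ℝ) (h1 : 0 ≤ z) (h2 : z ≤ 1) :
    Li 2 ((1 - z) / (1 + z)) - Li 2 (-((1 - z) / (1 + z))) - 2 * Li 2 (1 - z)
      + 1 / 2 * Li 2 (1 - z ^ 2) = 0 := by
  have := const_of (g := fun z => Li 2 ((1 - z) / (1 + z)) - Li 2 (-((1 - z) / (1 + z)))
      - 2 * Li 2 (1 - z) + 1 / 2 * Li 2 (1 - z ^ 2))
    (g' := fun _ => 0) h1 ?_ ?_ (fun _ _ _ => rfl)
  · beta_reduce at this
    rw [this]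
    norm_num [Li_neg_one_2]
    rw [← zeta']
    ring
  · exact (((kc1 2 le_rfl z h2).sub (kc2 2 le_rfl z h2)).sub
      ((kc3 2 le_rfl z h2).const_mul 2)).add ((kc5 2 le_rfl z h2).const_mul (1 / 2))
  · intro x a b
    have bd := kum_bd' x a (by linarith)
    have n1 : 1 + x ≠ 0 := by linarith
    have n2 : 1 - x ≠ 0 := by linarith
    have n3 : 1 - x ^ 2 ≠ 0 := by nlinarith
    have d1 := Li2_comp (kum_deriv x a) (by linarith) bd.2 bd.1.ne'
    have d2 := Li2_comp (kum_deriv x a).fun_neg (by linarith) (by linarith) (by linarith)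
    have d3 := Li2_comp (f := fun x => 1 - x) ((hasDerivAt_id' x).const_sub 1)
      (by linarith) (by linarith) n2
    have d5 := Li2_comp (kum5_deriv x) (by nlinarith) (by nlinarith) n3
    refine (((d1.fun_sub d2).fun_sub (d3.const_mul 2)).fun_add (d5.const_mul (1 / 2))).congr_deriv ?_
    rw [kum_log1 x a, kum_log2 x a, kum_log5, sub_sub_cancel]
    have e : 1 - x ^ 2 = (1 - x) * (1 + x) := by ring
    rw [e]
    field_simp
    ring

lemma kumB2 (z : ℝ) (h1 : 0 ≤ z) (h2 : z ≤ 1) :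
    Li 2 ((1 - z) / (1 + z)) - Li 2 (-((1 - z) / (1 + z))) - 2 * Li 2 (1 / (1 + z))
      - 1 / 2 * Li 2 (1 - z ^ 2) - Real.log (1 + z) ^ 2 = - zeta' 2 := by
  have := const_of (g := fun z => Li 2 ((1 - z) / (1 + z)) - Li 2 (-((1 - z) / (1 + z)))
      - 2 * Li 2 (1 / (1 + z)) - 1 / 2 * Li 2 (1 - z ^ 2) - Real.log (1 + z) ^ 2)
    (g' := fun _ => 0) h1 ?_ ?_ (fun _ _ _ => rfl)
  · beta_reduce at this
    rw [this]
    norm_num [Li_neg_one_2]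
    rw [← zeta']
    ring
  · exact ((((kc1 2 le_rfl z h2).sub (kc2 2 le_rfl z h2)).sub
      ((kc4 2 le_rfl z).const_mul 2)).sub ((kc5 2 le_rfl z h2).const_mul (1 / 2))).sub
      ((kc6 z).pow 2)
  · intro x a b
    have bd := kum_bd' x a (by linarith)
    have n1 : 1 + x ≠ 0 := by linarith
    have n2 : 1 - x ≠ 0 := by linarith
    have n3 : 1 - x ^ 2 ≠ 0 := by nlinarith
    have p1 : 0 < 1 / (1 + x) := by positivity
    have d1 := Li2_comp (kum_deriv x a) (by linarith) bd.2 bd.1.ne'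
    have d2 := Li2_comp (kum_deriv x a).fun_neg (by linarith) (by linarith) (by linarith)
    have d4 := Li2_comp (kum4_deriv x a)
      (by linarith) (by rw [div_lt_one (by linarith)]; linarith) p1.ne'
    have d5 := Li2_comp (kum5_deriv x) (by nlinarith) (by nlinarith) n3
    have d6 := (((hasDerivAt_id' x).const_add 1).log n1).fun_pow 2
    refine ((((d1.fun_sub d2).fun_sub (d4.const_mul 2)).fun_sub
      (d5.const_mul (1 / 2))).fun_sub d6).congr_deriv ?_
    rw [kum_log1 x a, kum_log2 x a, kum_log5, kum_log4 x a]
    have e : 1 - x ^ 2 = (1 - x) * (1 + x) := by ring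
    rw [e]
    push_cast
    field_simp
    ring

lemma kummer (z : ℝ) (h1 : 0 ≤ z) (h2 : z ≤ 1) :
    Li 3 ((1 - z) / (1 + z)) - Li 3 (-((1 - z) / (1 + z))) - 2 * Li 3 (1 - z)
      - 2 * Li 3 (1 / (1 + z)) + 1 / 2 * Li 3 (1 - z ^ 2)
      + 1 / 3 * Real.log (1 + z) ^ 3 - zeta' 2 * Real.log (1 + z) = - (7 / 4) * zeta' 3 := by
  have := const_of (g := fun z => Li 3 ((1 - z) / (1 + z)) - Li 3 (-((1 - z) / (1 + z)))
      - 2 * Li 3 (1 - z) - 2 * Li 3 (1 / (1 + z)) + 1 / 2 * Li 3 (1 - z ^ 2)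
      + 1 / 3 * Real.log (1 + z) ^ 3 - zeta' 2 * Real.log (1 + z))
    (g' := fun _ => 0) h1 ?_ ?_ (fun _ _ _ => rfl)
  · beta_reduce at this
    rw [this]
    norm_num [Li_neg_one_3]
    rw [← zeta']
    ring
  · have h3 : 2 ≤ 3 := by norm_num
    exact (((((((kc1 3 h3 z h2).sub (kc2 3 h3 z h2)).sub
      ((kc3 3 h3 z h2).const_mul 2)).sub
      ((kc4 3 h3 z).const_mul 2)).add ((kc5 3 h3 z h2).const_mul (1 / 2))).add
      (((kc6 z).pow 3).const_mul (1 / 3))).sub ((kc6 z).const_mul _))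
  · intro x a b
    have bd := kum_bd' x a (by linarith)
    have n1 : 1 + x ≠ 0 := by linarith
    have n2 : 1 - x ≠ 0 := by linarith
    have n3 : 1 - x ^ 2 ≠ 0 := by nlinarith
    have p1 : 0 < 1 / (1 + x) := by positivity
    have d1 := Li3_comp (kum_deriv x a) (by linarith) bd.2 bd.1.ne'
    have d2 := Li3_comp (kum_deriv x a).fun_neg (by linarith) (by linarith) (by linarith)
    have d3 := Li3_comp (f := fun x => 1 - x) ((hasDerivAt_id' x).const_sub 1)
      (by linarith) (by linarith) n2
    have d4 := Li3_comp (kum4_deriv x a)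
      (by linarith) (by rw [div_lt_one (by linarith)]; linarith) p1.ne'
    have d5 := Li3_comp (kum5_deriv x) (by nlinarith) (by nlinarith) n3
    have l := ((hasDerivAt_id' x).const_add 1).log n1
    refine ((((((d1.fun_sub d2).fun_sub (d3.const_mul 2)).fun_sub (d4.const_mul 2)).fun_add
      (d5.const_mul (1 / 2))).fun_add ((l.fun_pow 3).const_mul (1 / 3))).fun_sub
      (l.const_mul (zeta' 2))).congr_deriv ?_
    have b1 := kumB1 x a.le (by linarith)
    have b2 := kumB2 x a.le (by linarith)
    generalize Li 2 ((1 - x) / (1 + x)) = A at *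
    generalize Li 2 (-((1 - x) / (1 + x))) = B at *
    generalize Li 2 (1 - x) = C at *
    generalize Li 2 (1 / (1 + x)) = D at *
    generalize Li 2 (1 - x ^ 2) = E at *
    generalize Real.log (1 + x) = F at *
    have e : 1 - x ^ 2 = (1 - x) * (1 + x) := by ring
    rw [e]
    have hC : C = (A - B + 1 / 2 * E) / 2 := by linarith
    have hD : D = (A - B - 1 / 2 * E - F ^ 2 + zeta' 2) / 2 := by linarith
    rw [hC, hD]
    push_cast
    field_simp
    ring

lemma log_vals : Real.log (1 / 2) = - Real.log 2 ∧ Real.log (2 / 3) = Real.log 2 - Real.log 3 ∧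
    Real.log (1 / 3) = - Real.log 3 ∧ Real.log (3 / 4) = Real.log 3 - 2 * Real.log 2 ∧
    Real.log (1 / 4) = - 2 * Real.log 2 ∧ Real.log (3 / 2) = Real.log 3 - Real.log 2 := by
  have h4 : Real.log 4 = 2 * Real.log 2 := by
    rw [show (4 : ℝ) = 2 ^ 2 by norm_num, Real.log_pow]
    norm_num
  refine ⟨?_, ?_, ?_, ?_, ?_, ?_⟩ <;> rw [Real.log_div (by norm_num) (by norm_num)] <;>
    simp [h4]

lemma third : 1 / 2 * Li 3 (-(1 / 3)) - Li 3 (1 / 3) = - (1 / 12) * Real.log 3 ^ 3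
    + 1 / 2 * zeta' 2 * Real.log 3 - 13 / 12 * zeta' 3 := by
  obtain ⟨l1, l2, l3, l4, l5, l6⟩ := log_vals
  have k := kummer (1 / 2) (by norm_num) (by norm_num)
  have a1 := Landen3 (1 / 2) (by norm_num) (by norm_num)
  have a2 := Landen3 (2 / 3) (by norm_num) (by norm_num)
  have a3 := Landen3 (3 / 4) (by norm_num) (by norm_num)
  have du := Li_dup 3 (by norm_num) (1 / 2) (by rw [abs_of_pos] <;> norm_num)
  rw [show ((1 : ℝ) - 1 / 2) / (1 + 1 / 2) = 1 / 3 by norm_num,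
    show (1 : ℝ) - 1 / 2 = 1 / 2 by norm_num, show (1 : ℝ) / (1 + 1 / 2) = 2 / 3 by norm_num,
    show (1 : ℝ) - (1 / 2) ^ 2 = 3 / 4 by norm_num, show (1 : ℝ) + 1 / 2 = 3 / 2 by norm_num, l6] at k
  rw [show (1 : ℝ) - 1 / 2 = 1 / 2 by norm_num, show (1 : ℝ) - 1 / (1 / 2) = -1 by norm_num,
    l1, Li_neg_one_3] at a1
  rw [show (1 : ℝ) - 2 / 3 = 1 / 3 by norm_num, show (1 : ℝ) - 1 / (2 / 3) = -(1 / 2) by norm_num,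
    l2, l3] at a2
  rw [show (1 : ℝ) - 3 / 4 = 1 / 4 by norm_num, show (1 : ℝ) - 1 / (3 / 4) = -(1 / 3) by norm_num,
    l4, l5] at a3
  rw [show ((1 : ℝ) / 2) ^ 2 = 1 / 4 by norm_num] at du
  linear_combination (-1 / 3) * k + (-2 / 3) * a1 * 1 + (-2 / 3) * a2 + (1 / 6) * a3 + (2 / 3) * du

lemma half_val : Li 2 (1 / 2) = 1 / 2 * zeta' 2 - 1 / 2 * Real.log 2 ^ 2 := by
  have h := reflect_half (1 / 2) le_rfl (by norm_num)
  obtain ⟨l1, -⟩ := log_vals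
  rw [show (1 : ℝ) - 1 / 2 = 1 / 2 by norm_num, l1] at h
  linarith

lemma inv_cont (a u : ℝ) (f : ℝ → ℝ) (hf : ContinuousOn f (Set.Icc a u)) (k : ℕ) (hk : 2 ≤ k)
    (h : ∀ x ∈ Set.Icc a u, 1 ≤ |f x|) : ContinuousOn (fun x => Li k (1 / f x)) (Set.Icc a u) := by
  apply Li_comp_cont k hk
  · apply ContinuousOn.div continuousOn_const hf
    intro x hx h0
    have := h x hx
    rw [h0] at this
    norm_num at this
  · intro x hx
    apply abs_le.1
    rw [abs_div, abs_one]
    exact div_le_one_of_le₀ (h x hx) (abs_nonneg _)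

lemma inv_bd (y : ℝ) (h : 1 < |y|) : -1 < 1 / y ∧ 1 / y < 1 ∧ 1 / y ≠ 0 := by
  have hy : y ≠ 0 := by
    rintro rfl
    norm_num at h
  have : |1 / y| < 1 := by
    rw [abs_div, abs_one]
    exact (div_lt_one (by linarith)).2 h
  exact ⟨(abs_lt.1 this).1, (abs_lt.1 this).2, one_div_ne_zero hy⟩

lemma inv_deriv {f : ℝ → ℝ} {f' x : ℝ} (hf : HasDerivAt f f' x) (h : f x ≠ 0) :
    HasDerivAt (fun y => 1 / f y) (- f' / f x ^ 2) x := by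
  refine ((hasDerivAt_const x 1).fun_div hf h).congr_deriv ?_
  simp

lemma P2_deriv (u : ℝ) (hu : 1 < u) :
    HasDerivAt (fun u => Li 2 (1 / u) + 1 / 2 * Real.log u ^ 2 - 1 / 2 * zeta' 2)
      (Real.log (u - 1) / u) u := by
  have u0 : u ≠ 0 := by linarith
  have u1 : u - 1 ≠ 0 := by linarith
  obtain ⟨b1, b2, b3⟩ := inv_bd u (by rw [abs_of_pos] <;> linarith)
  have d1 := Li2_comp (inv_deriv (hasDerivAt_id' u) u0) b1 b2 b3
  have d2 := ((Real.hasDerivAt_log u0).fun_pow 2).const_mul (1 / 2 : ℝ)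
  refine ((d1.fun_add d2).sub_const _).congr_deriv ?_
  have e : 1 - 1 / u = (u - 1) / u := by field_simp
  rw [e, Real.log_div u1 u0]
  push_cast
  field_simp
  ring

/-- The claimed formula. -/
noncomputable def F3 (u : ℝ) : ℝ :=
  (1 / 2) * Li 3 (1 / (u * (2 - u))) - Li 3 (1 / u) - Li 3 (1 / (2 - u))
        + Li 2 (1 / u) * Real.log (u - 2)
        + (1 / 3) * zeta' 3 - (1 / 2) * zeta' 2 * Real.log u
        + (1 / 12) * (Real.log (u * (u - 2))) ^ 3
        - (1 / 2) * (Real.log (u - 2)) ^ 2 * Real.log u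

lemma F3_three : F3 3 = 0 := by
  have t := third
  unfold F3
  rw [show (1 : ℝ) / (3 * (2 - 3)) = -(1 / 3) by norm_num, show (1 : ℝ) / (2 - 3) = -1 by norm_num,
    show (3 : ℝ) - 2 = 1 by norm_num, Real.log_one, mul_one, Li_neg_one_3]
  linear_combination t

lemma F3_cont (u : ℝ) : ContinuousOn F3 (Set.Icc 3 u) := by
  have c1 := inv_cont 3 u (fun x => x * (2 - x)) (by fun_prop) 3 (by norm_num) (by
    intro x hx
    have := hx.1
    rw [abs_of_neg] <;> nlinarith)
  have c2 := fun k hk => inv_cont 3 u (fun x => x) (by fun_prop) k hk (by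
    intro x hx
    have := hx.1
    rw [abs_of_pos] <;> linarith)
  have c3 := inv_cont 3 u (fun x => 2 - x) (by fun_prop) 3 (by norm_num) (by
    intro x hx
    have := hx.1
    rw [abs_of_neg] <;> linarith)
  have l1 : ContinuousOn (fun x => Real.log x) (Set.Icc 3 u) := by
    apply ContinuousOn.log (by fun_prop)
    intro x hx
    have := hx.1
    linarith
  have l2 : ContinuousOn (fun x => Real.log (x - 2)) (Set.Icc 3 u) := by
    apply ContinuousOn.log (by fun_prop)
    intro x hx
    have := hx.1
    linarith
  have l3 : ContinuousOn (fun x => Real.log (x * (x - 2))) (Set.Icc 3 u) := by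
    apply ContinuousOn.log (by fun_prop)
    intro x hx
    have := hx.1
    nlinarith
  exact (((((((c1.const_mul (1 / 2)).sub (c2 3 (by norm_num))).sub c3).add
    ((c2 2 le_rfl).mul l2)).add continuousOn_const).sub (l1.const_mul _)).add
    ((l3.pow 3).const_mul _)).sub (((l2.pow 2).const_mul _).mul l1)

lemma dilog_rel (u : ℝ) (hu : 3 ≤ u) :
    Li 2 (1 / (2 - u)) = - Li 2 (1 / (u - 1)) - 1 / 2 * (Real.log (u - 1) - Real.log (u - 2)) ^ 2 ∧
    Li 2 (1 / (u * (2 - u))) = 2 * (Li 2 (1 / (2 - u)) + Li 2 (1 / u)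
      + 1 / 4 * (Real.log u - Real.log (u - 2)) ^ 2) := by
  have n0 : u ≠ 0 := by linarith
  have n1 : u - 1 ≠ 0 := by linarith
  have n2 : u - 2 ≠ 0 := by linarith
  have n2' : 2 - u ≠ 0 := by linarith
  have hx : 1 / (u - 1) ≤ 1 / 2 := one_div_le_one_div_of_le (by norm_num) (by linarith)
  have hx0 : 0 < 1 / (u - 1) := by
    apply div_pos <;> linarith
  have a1 := Landen2 (1 / (u - 1)) (by linarith) hx
  have a2 := Landen2 (-(1 / (u - 1))) (by linarith) (by linarith)
  have a3 := Landen2 ((1 / (u - 1)) ^ 2) (by nlinarith) (by nlinarith)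
  have du := Li_dup 2 le_rfl (1 / (u - 1)) (by rw [abs_of_pos hx0]; linarith)
  have e1 : 1 - 1 / (u - 1) = (u - 2) / (u - 1) := by field_simp; ring
  have e2 : 1 - -(1 / (u - 1)) = u / (u - 1) := by field_simp; ring
  have e3 : 1 - (1 / (u - 1)) ^ 2 = ((u - 2) / (u - 1)) * (u / (u - 1)) := by field_simp; ring
  have f1 : 1 / (u - 1) / (1 / (u - 1) - 1) = 1 / (2 - u) := by
    rw [show 1 / (u - 1) - 1 = (2 - u) / (u - 1) by field_simp; ring]
    field_simp
  have f2 : -(1 / (u - 1)) / (-(1 / (u - 1)) - 1) = 1 / u := by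
    rw [show -(1 / (u - 1)) - 1 = - u / (u - 1) by field_simp; ring]
    field_simp
  have f3 : (1 / (u - 1)) ^ 2 / ((1 / (u - 1)) ^ 2 - 1) = 1 / (u * (2 - u)) := by
    rw [show (1 / (u - 1)) ^ 2 - 1 = u * (2 - u) / (u - 1) ^ 2 by field_simp; ring]
    field_simp
  rw [e1, f1, Real.log_div n2 n1] at a1
  rw [e2, f2, Real.log_div n0 n1] at a2
  rw [e3, f3, Real.log_mul (div_ne_zero n2 n1) (div_ne_zero n0 n1), Real.log_div n2 n1,
    Real.log_div n0 n1] at a3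
  constructor
  · linarith
  · linear_combination a3 - 2 * a1 - 2 * a2 + 2 * du

lemma F3_deriv (u : ℝ) (hu : 3 < u) :
    HasDerivAt F3 ((Li 2 (1 / (u - 1)) + 1 / 2 * Real.log (u - 1) ^ 2 - 1 / 2 * zeta' 2) / u) u := by
  have n0 : u ≠ 0 := by linarith
  have n1 : u - 1 ≠ 0 := by linarith
  have n2 : u - 2 ≠ 0 := by linarith
  have n2' : 2 - u ≠ 0 := by linarith
  have m1 : u * (2 - u) ≠ 0 := mul_ne_zero n0 n2'
  have m2 : u * (u - 2) ≠ 0 := mul_ne_zero n0 n2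
  obtain ⟨b1, b2, b3⟩ := inv_bd u (by rw [abs_of_pos] <;> linarith)
  obtain ⟨c1, c2, c3⟩ := inv_bd (2 - u) (by rw [abs_of_neg] <;> linarith)
  obtain ⟨d1, d2, d3⟩ := inv_bd (u * (2 - u)) (by rw [abs_of_neg] <;> nlinarith)
  have i := hasDerivAt_id' u
  have t1 := Li3_comp (inv_deriv (i.fun_mul (i.const_sub 2)) m1) d1 d2 d3
  have t2 := Li3_comp (inv_deriv i n0) b1 b2 b3
  have t3 := Li3_comp (inv_deriv (i.const_sub 2) n2') c1 c2 c3
  have t4 := Li2_comp (inv_deriv i n0) b1 b2 b3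
  have l1 := Real.hasDerivAt_log n0
  have l2 := (i.sub_const 2).log n2
  have l3 := (i.fun_mul (i.sub_const 2)).log m2
  refine ((((((((t1.const_mul (1 / 2 : ℝ)).fun_sub t2).fun_sub t3).fun_add
    (t4.fun_mul l2)).add_const (1 / 3 * zeta' 3)).fun_sub (l1.const_mul (1 / 2 * zeta' 2))).fun_add
    ((l3.fun_pow 3).const_mul (1 / 12 : ℝ))).fun_sub
    (((l2.fun_pow 2).const_mul (1 / 2 : ℝ)).fun_mul l1)).congr_deriv ?_
  obtain ⟨r1, r2⟩ := dilog_rel u hu.le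
  have e : 1 - 1 / u = (u - 1) / u := by field_simp
  rw [r2, r1, e, Real.log_div n1 n0, Real.log_mul n0 n2]
  generalize Li 2 (1 / (u - 1)) = A
  generalize Li 2 (1 / u) = B
  generalize Real.log (u - 1) = M
  generalize Real.log (u - 2) = l
  generalize Real.log u = L
  rw [show 2 - u = -(u - 2) by ring]
  push_cast
  field_simp
  ring

/-- Theorem 4: For every real `u ≥ 3`, the Furry probability of weight three
satisfies
`P₃(u) = ½·Li₃(1/(u(2−u))) − Li₃(1/u) − Li₃(1/(2−u)) + Li₂(1/u)·log(u−2)`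
`       + ⅓ζ(3) − ½ζ(2)·log(u) + (1/12)·log³(u(u−2)) − ½·log²(u−2)·log(u)`. -/
theorem furry_P3
    (P : ℕ → ℝ → ℝ)
    (hP0 : ∀ u : ℝ, 0 ≤ u → P 0 u = 1)
    (hPcont : ∀ k : ℕ, ContinuousOn (P (k + 1)) (Set.Ici ((k : ℝ) + 1)))
    (hPinit : ∀ k : ℕ, P (k + 1) ((k : ℝ) + 1) = 0)
    (hPderiv : ∀ k : ℕ, ∀ u : ℝ, (k : ℝ) + 1 < u →
      HasDerivAt (P (k + 1)) (P k (u - 1) / u) u) :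
    ∀ u : ℝ, 3 ≤ u →
      P 3 u = (1 / 2) * Li 3 (1 / (u * (2 - u))) - Li 3 (1 / u) - Li 3 (1 / (2 - u))
        + Li 2 (1 / u) * Real.log (u - 2)
        + (1 / 3) * zeta' 3 - (1 / 2) * zeta' 2 * Real.log u
        + (1 / 12) * (Real.log (u * (u - 2))) ^ 3
        - (1 / 2) * (Real.log (u - 2)) ^ 2 * Real.log u := by
  have h1 : ∀ u : ℝ, 1 ≤ u → P 1 u = Real.log u := by
    intro u hu
    have := const_of (g := fun u => P 1 u - Real.log u) (g' := fun x => P 0 (x - 1) / x - x⁻¹) hu ?_ ?_ ?_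
    · have i := hPinit 0
      norm_num at i
      simp [i] at this
      linarith
    · have c := hPcont 0
      norm_num at c
      apply (c.mono Set.Icc_subset_Ici_self).sub
      apply ContinuousOn.log continuousOn_id
      intro x hx
      have := hx.1
      simp only [id]
      linarith
    · intro x a b
      have d := hPderiv 0 x (by simpa using a)
      norm_num at d
      exact d.fun_sub (Real.hasDerivAt_log (by linarith))
    · intro x a b
      rw [hP0 _ (by linarith), one_div, sub_self]
  have h2 : ∀ u : ℝ, 2 ≤ u → P 2 u = Li 2 (1 / u) + 1 / 2 * Real.log u ^ 2 - 1 / 2 * zeta' 2 := by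
    intro u hu
    have := const_of (g := fun u => P 2 u - (Li 2 (1 / u) + 1 / 2 * Real.log u ^ 2 - 1 / 2 * zeta' 2))
      (g' := fun x => P 1 (x - 1) / x - Real.log (x - 1) / x) hu ?_ ?_ ?_
    · have i := hPinit 1
      norm_num at i
      beta_reduce at this
      rw [i, half_val] at this
      linarith
    · have c := hPcont 1
      norm_num at c
      apply (c.mono Set.Icc_subset_Ici_self).sub
      intro x hx
      exact (P2_deriv x (by linarith [hx.1])).continuousAt.continuousWithinAt
    · intro x a b
      have d := hPderiv 1 x (by norm_num; linarith)
      norm_num at d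
      exact d.fun_sub (P2_deriv x (by linarith))
    · intro x a b
      rw [h1 _ (by linarith), sub_self]
  intro u hu
  change P 3 u = F3 u
  have := const_of (g := fun u => P 3 u - F3 u)
      (g' := fun x => P 2 (x - 1) / x - (Li 2 (1 / (x - 1)) + 1 / 2 * Real.log (x - 1) ^ 2
        - 1 / 2 * zeta' 2) / x) hu ?_ ?_ ?_
  · have i := hPinit 2
    norm_num at i
    beta_reduce at this
    rw [i, F3_three] at this
    linarith
  · have c := hPcont 2
    norm_num at c
    exact (c.mono Set.Icc_subset_Ici_self).sub (F3_cont u)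
  · intro x a b
    have d := hPderiv 2 x (by norm_num; linarith)
    norm_num at d
    exact d.fun_sub (F3_deriv x a)
  · intro x a b
    rw [h2 _ (by linarith), sub_self]
end
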